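/- Landsberg–Michałek border rank lower bound for matrix multiplication: let m ≥ 1 and let T = ∑_{i,j,k=1}^{m} x_{ij} y_{jk} z_{ki} (= trace(XYZ)) be the matrix multiplication trilinear polynomial in the 3m² complex variables x_{ij}, y_{jk}, z_{ki}. Suppose r is such that there exists a sequence of polynomials, each of the form ∑_{ρ=1}^{r} u_ρ v_ρ w_ρ where u_ρ is a homogeneous linear form in the x-variables, v_ρ in the y-variables, and w_ρ in the z-variables, whose coefficients converge to the coefficients of T. Then r ≥ 2m² − ⌈log₂ m⌉ − 1. -/

import Mathlib

open MvPolynomial Filter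

/-- A homogeneous linear form in the variables of class `c` (class `0` is the
`x`-variables, class `1` the `y`-variables, class `2` the `z`-variables). -/
def IsLinForm (m : ℕ) (c : Fin 3) (u : MvPolynomial (Fin 3 × (Fin m × Fin m)) ℂ) : Prop :=
  ∃ a : Fin m × Fin m → ℂ, u = ∑ p : Fin m × Fin m, C (a p) * X (c, p)

/-- The matrix multiplication trilinear polynomial
`T = ∑_{i,j,k} x_{ij} y_{jk} z_{ki} = trace(XYZ)`, with `x_{ij} = X(0,(i,j))`,
`y_{jk} = X(1,(j,k))`, `z_{ki} = X(2,(k,i))`. -/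
noncomputable def matMulPoly (m : ℕ) : MvPolynomial (Fin 3 × (Fin m × Fin m)) ℂ :=
  ∑ i : Fin m, ∑ j : Fin m, ∑ k : Fin m,
    X ((0 : Fin 3), (i, j)) * X ((1 : Fin 3), (j, k)) * X ((2 : Fin 3), (k, i))

theorem choose_mul_choose_le (N i j : ℕ) :
    (N + i).choose N * (N + j).choose N ≤ (N + (i * j + i + j)).choose N := by
  induction N with
  | zero => simp
  | succ N ih =>
    have key (a : ℕ) : (N + 1 + a).choose (N + 1) * (N + 1) = (N + 1 + a) * (N + a).choose N := by
      rw [show N + 1 + a = (N + a) + 1 by ring]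
      exact (Nat.add_one_mul_choose_eq (N + a) N).symm
    have hpos : 0 < (N + 1) * (N + 1) := by positivity
    refine Nat.le_of_mul_le_mul_right ?_ hpos
    calc (N + 1 + i).choose (N + 1) * (N + 1 + j).choose (N + 1) * ((N + 1) * (N + 1))
        = ((N + 1 + i).choose (N + 1) * (N + 1)) * ((N + 1 + j).choose (N + 1) * (N + 1)) := by ring
      _ = ((N + 1 + i) * (N + 1 + j)) * ((N + i).choose N * (N + j).choose N) := by
          rw [key, key]; ring
      _ ≤ ((N + 1) * (N + 1 + (i * j + i + j))) * (N + (i * j + i + j)).choose N := by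
          refine Nat.mul_le_mul ?_ ih
          nlinarith [Nat.zero_le (N * (i * j))]
      _ = (N + 1 + (i * j + i + j)).choose (N + 1) * (N + 1) * (N + 1) := by rw [key]; ring
      _ = _ := by ring

theorem two_pow_mul_choose_le (N q : ℕ) (hq : q ≤ N) :
    2 ^ q * (2 * N - q).choose (N + 1) ≤ (2 * N).choose (N + 1) := by
  induction q with
  | zero => simp
  | succ q ih =>
    refine le_trans ?_ (ih (by omega))
    obtain ⟨M, hM⟩ : ∃ M, 2 * N - q = M + 1 := ⟨2 * N - q - 1, by omega⟩
    rw [show 2 * N - (q + 1) = M by omega, hM, pow_succ, mul_assoc]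
    refine Nat.mul_le_mul_left _ ?_
    rw [Nat.choose_succ_succ' M N]
    have : M.choose (N + 1) ≤ M.choose N := by
      rcases Nat.lt_or_ge M (N + 1) with h | h
      · simp [Nat.choose_eq_zero_of_lt h]
      · have := Nat.choose_succ_right_eq M N
        have h2 : M - N ≤ N + 1 := by omega
        nlinarith [Nat.mul_le_mul_left (M.choose N) h2]
    omega

theorem succ_mul_choose_lt_centralBinom (N q : ℕ) (hq : q ≤ N) (h : N + 1 ≤ 2 ^ q) :
    (N + 1) * (N + (N - q)).choose (N + 1) < (2 * N).choose N := by
  rw [show N + (N - q) = 2 * N - q by omega]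
  calc _ ≤ 2 ^ q * (2 * N - q).choose (N + 1) := Nat.mul_le_mul_right _ h
    _ ≤ (2 * N).choose (N + 1) := two_pow_mul_choose_le N q hq
    _ < _ := by
      have := Nat.choose_succ_right_eq (2 * N) N
      have hp : 0 < (2 * N).choose N := Nat.choose_pos (by omega)
      rw [show 2 * N - N = N by omega] at this
      nlinarith

/-- For a lower set of boxes, the corner rectangle of each box bounds the weight of the box
by the number of boxes. -/
theorem sum_rectangle_le {N : ℕ} (s : ℕ) (S : Finset (ℕ × ℕ)) (hS : S.card = s)
    (hl : ∀ b ∈ S, ∀ b', b' ≤ b → b' ∈ S) :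
    ∑ b ∈ S, (N + b.1).choose N * (N + b.2).choose N ≤ (N + s).choose (N + 1) := by
  induction s generalizing S with
  | zero => simp [Finset.card_eq_zero.1 hS]
  | succ s ih =>
    obtain ⟨b, hb⟩ : ∃ b, Maximal (· ∈ S) b :=
      S.exists_maximal (Finset.card_pos.1 (by omega))
    rw [← Finset.sum_erase_add _ _ hb.1]
    have h1 := ih (S.erase b) (by rw [Finset.card_erase_of_mem hb.1]; omega) (by
      intro x hx y hy
      rw [Finset.mem_erase] at hx ⊢
      refine ⟨?_, hl x hx.2 y hy⟩
      rintro rfl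
      exact hx.1 (le_antisymm (hb.2 hx.2 hy) hy))
    have h2 : (b.1 + 1) * (b.2 + 1) ≤ s + 1 := by
      rw [← hS]
      have : Finset.range (b.1 + 1) ×ˢ Finset.range (b.2 + 1) ⊆ S := by
        intro x hx
        simp only [Finset.mem_product, Finset.mem_range] at hx
        exact hl b hb.1 x ⟨by omega, by omega⟩
      simpa using Finset.card_le_card this
    have h3 : (N + b.1).choose N * (N + b.2).choose N ≤ (N + s).choose N :=
      (choose_mul_choose_le N b.1 b.2).trans (Nat.choose_le_choose N (by nlinarith))
    rw [show N + (s + 1) = (N + s) + 1 by ring, Nat.choose_succ_succ']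
    omega

/-- The number of elements of `I` below `k`. -/
def countBelow (I : Finset ℕ) (k : ℕ) : ℕ := (I.filter (· < k)).card

/-- Pairs `(I, k)` of an `N`-subset of `{0, …, 2N}` and an element outside it. -/
def koszulPairs (N : ℕ) : Finset (Finset ℕ × ℕ) :=
  ((Finset.range (2 * N + 1)).powersetCard N ×ˢ Finset.range (2 * N + 1)).filter
    fun u => u.2 ∉ u.1

theorem mem_koszulPairs {N : ℕ} {u : Finset ℕ × ℕ} :
    u ∈ koszulPairs N ↔
      u.1 ⊆ Finset.range (2 * N + 1) ∧ u.1.card = N ∧ u.2 < 2 * N + 1 ∧ u.2 ∉ u.1 := by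
  simp [koszulPairs, Finset.mem_powersetCard, and_assoc]

theorem card_koszulPairs (N : ℕ) :
    (koszulPairs N).card = (N + 1) * (2 * N + 1).choose N := by
  have h : koszulPairs N = (((Finset.range (2 * N + 1)).powersetCard N).sigma
      (fun I => Finset.range (2 * N + 1) \ I)).map (Equiv.sigmaEquivProd _ _).toEmbedding := by
    ext u
    simp [koszulPairs, Finset.mem_map_equiv, and_assoc]
  rw [h, Finset.card_map, Finset.card_sigma, Finset.sum_congr rfl (g := fun _ => N + 1)]
  · simp [Finset.card_powersetCard, mul_comm]
  · intro I hI
    rw [Finset.mem_powersetCard] at hI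
    rw [Finset.card_sdiff_of_subset hI.1, Finset.card_range, hI.2]
    omega

theorem countBelow_le (I : Finset ℕ) (k : ℕ) : countBelow I k ≤ k := by
  calc _ ≤ (Finset.range k).card :=
        Finset.card_le_card fun x hx => by simpa using (Finset.mem_filter.1 hx).2
    _ = k := by simp

theorem countBelow_le_of_mem {N : ℕ} {u : Finset ℕ × ℕ} (hu : u ∈ koszulPairs N) :
    countBelow u.1 u.2 ≤ N :=
  (Finset.card_filter_le _ _).trans_eq (mem_koszulPairs.1 hu).2.1

theorem sub_countBelow_le_of_mem {N : ℕ} {u : Finset ℕ × ℕ} (hu : u ∈ koszulPairs N) :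
    u.2 - countBelow u.1 u.2 ≤ N := by
  obtain ⟨h1, h2, h3, h4⟩ := mem_koszulPairs.1 hu
  have h5 : (u.1.filter (¬ · < u.2)).card ≤ (Finset.Ioo u.2 (2 * N + 1)).card := by
    refine Finset.card_le_card fun x hx => ?_
    rw [Finset.mem_filter] at hx
    have := Finset.mem_range.1 (h1 hx.1)
    have : x ≠ u.2 := fun h => h4 (h ▸ hx.1)
    simp; omega
  have h6 := Finset.card_filter_add_card_filter_not (s := u.1) (· < u.2)
  rw [Nat.card_Ioo] at h5
  unfold countBelow
  omega

theorem card_filter_koszulPairs_le (N i j : ℕ) (hi : i ≤ N) (hj : j ≤ N) :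
    ((koszulPairs N).filter fun u => countBelow u.1 u.2 = i ∧ u.2 - countBelow u.1 u.2 = N - j).card
      ≤ (N + i).choose N * (N + j).choose N := by
  have hle : ((koszulPairs N).filter
      fun u => countBelow u.1 u.2 = i ∧ u.2 - countBelow u.1 u.2 = N - j).card ≤
      (((Finset.range (i + (N - j))).powersetCard i) ×ˢ
        ((Finset.Ioo (i + (N - j)) (2 * N + 1)).powersetCard (N - i))).card := by
    refine Finset.card_le_card_of_injOn (fun u => (u.1.filter (· < u.2), u.1.filter (¬ · < u.2)))
      ?_ ?_
    · intro u hu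
      rw [Finset.mem_coe, Finset.mem_filter] at hu
      obtain ⟨hu, h1, h2⟩ := hu
      obtain ⟨h3, h4, h5, h6⟩ := mem_koszulPairs.1 hu
      have h7 := countBelow_le u.1 u.2
      have hk : u.2 = i + (N - j) := by omega
      have h8 := Finset.card_filter_add_card_filter_not (s := u.1) (· < u.2)
      simp only [Finset.coe_product, Set.mem_prod, Finset.mem_coe, Finset.mem_powersetCard]
      refine ⟨⟨fun x hx => ?_, h1⟩, fun x hx => ?_, ?_⟩
      · simpa [hk] using (Finset.mem_filter.1 hx).2
      · rw [Finset.mem_filter] at hx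
        have := Finset.mem_range.1 (h3 hx.1)
        have : x ≠ u.2 := fun h => h6 (h ▸ hx.1)
        simp; omega
      · unfold countBelow at h1
        omega
    · intro u hu v hv huv
      rw [Finset.mem_coe, Finset.mem_filter] at hu hv
      have h7 := countBelow_le u.1 u.2
      have h8 := countBelow_le v.1 v.2
      simp only [Prod.mk.injEq] at huv
      refine Prod.ext ?_ (by omega)
      rw [← Finset.filter_union_filter_not_eq (· < u.2) u.1,
        ← Finset.filter_union_filter_not_eq (· < v.2) v.1, huv.1, huv.2]
  refine hle.trans ?_
  rw [Finset.card_product, Finset.card_powersetCard, Finset.card_powersetCard, Finset.card_range,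
    Nat.card_Ioo]
  refine Nat.mul_le_mul ?_ ?_
  · rw [Nat.choose_symm_add (a := N) (b := i)]
    exact Nat.choose_le_choose i (by omega)
  · rw [Nat.choose_symm_add (a := N) (b := j)]
    have : 2 * N + 1 - (i + (N - j)) - 1 = (N - i) + j := by omega
    rw [this, Nat.choose_symm_add]
    exact Nat.choose_le_choose j (by omega)

theorem sum_filter_lt_le (A : Finset ℕ) (k κ : ℕ) :
    ∑ x ∈ A.filter (· < k), (2 * (κ : ℤ) - 1 - 2 * x) ≤
      ∑ x ∈ A.filter (· < κ), (2 * (κ : ℤ) - 1 - 2 * x) := by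
  rw [Finset.sum_filter, Finset.sum_filter]
  refine Finset.sum_le_sum fun x _ => ?_
  split_ifs <;> omega

theorem sum_filter_lt_lt {A : Finset ℕ} {k κ : ℕ} (hk : k ∈ A) (hκ : κ ∈ A) (hne : k ≠ κ) :
    ∑ x ∈ A.filter (· < k), (2 * (κ : ℤ) - 1 - 2 * x) <
      ∑ x ∈ A.filter (· < κ), (2 * (κ : ℤ) - 1 - 2 * x) := by
  rw [Finset.sum_filter, Finset.sum_filter]
  refine Finset.sum_lt_sum (fun x _ => by split_ifs <;> omega) ?_
  rcases lt_or_gt_of_ne hne with h | h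
  · exact ⟨k, hk, by rw [if_neg (by omega), if_pos h]; omega⟩
  · exact ⟨κ, hκ, by rw [if_pos h, if_neg (by omega)]; omega⟩

/-- The potential ordering the pairs `(I, k)` so that the Koszul flattening is triangular. -/
def potential (u : Finset ℕ × ℕ) : ℤ :=
  ∑ x ∈ u.1, (x : ℤ) ^ 2 + 2 * ∑ x ∈ Finset.range u.2 \ u.1, (x : ℤ) +
    (u.2 - countBelow u.1 u.2 : ℤ)

theorem card_range_sdiff (I : Finset ℕ) (k : ℕ) :
    ((Finset.range k \ I).card : ℤ) = k - countBelow I k := by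
  have h : (Finset.range k \ I) = Finset.range k \ I.filter (· < k) := by
    ext x; simp; grind
  have hs : I.filter (· < k) ⊆ Finset.range k := fun x hx => by
    simpa using (Finset.mem_filter.1 hx).2
  rw [h, Finset.card_sdiff_of_subset hs, Nat.cast_sub (Finset.card_le_card hs), Finset.card_range]
  rfl

theorem sum_range_sdiff_add (f : ℕ → ℤ) (I : Finset ℕ) (k : ℕ) :
    ∑ x ∈ Finset.range k \ I, f x + ∑ x ∈ I.filter (· < k), f x = ∑ x ∈ Finset.range k, f x := by
  have h : (Finset.range k \ I) = Finset.range k \ I.filter (· < k) := by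
    ext x; simp; grind
  rw [h]
  exact Finset.sum_sdiff fun x hx => by simpa using (Finset.mem_filter.1 hx).2

theorem two_mul_sum_range (k : ℕ) : 2 * ∑ x ∈ Finset.range k, (x : ℤ) = k ^ 2 - k := by
  induction k with
  | zero => simp
  | succ k ih => rw [Finset.sum_range_succ, mul_add, ih]; push_cast; ring

theorem filter_lt_insert (I : Finset ℕ) (k : ℕ) :
    (insert k I).filter (· < k) = I.filter (· < k) := by
  rw [Finset.filter_insert, if_neg (lt_irrefl k)]

theorem potential_eq_insert {u : Finset ℕ × ℕ} (hu : u.2 ∉ u.1) :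
    potential u = ∑ x ∈ insert u.2 u.1, (x : ℤ) ^ 2 -
      2 * ∑ x ∈ (insert u.2 u.1).filter (· < u.2), (x : ℤ) - countBelow u.1 u.2 := by
  rw [Finset.sum_insert hu, filter_lt_insert, potential]
  have h1 := sum_range_sdiff_add (fun x => (x : ℤ)) u.1 u.2
  have h2 := two_mul_sum_range u.2
  linarith

theorem sum_range_sdiff_eq (f : ℕ → ℤ) {I : Finset ℕ} {k M : ℕ} (hk : k ≤ M) :
    ∑ x ∈ Finset.range k \ I, f x = ∑ x ∈ (Finset.range M \ I).filter (· < k), f x := by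
  congr 1
  ext x; simp; constructor
  · rintro ⟨h1, h2⟩; exact ⟨⟨by omega, h2⟩, h1⟩
  · rintro ⟨⟨_, h2⟩, h1⟩; exact ⟨h1, h2⟩

theorem potential_le {u v : Finset ℕ × ℕ} (hu : u.2 ∉ u.1) (hv : v.2 ∉ v.1) {κ : ℕ} (hκ : κ ∉ u.1)
    (hins : insert v.2 v.1 = insert κ u.1)
    (hsum : (κ : ℤ) = countBelow v.1 v.2 + (u.2 - countBelow u.1 u.2)) :
    potential v ≤ potential u ∧ (potential v = potential u → u = v) := by
  have hv' := potential_eq_insert hv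
  rw [hins, Finset.sum_insert hκ] at hv'
  have hcv : (((insert κ u.1).filter (· < v.2)).card : ℤ) = countBelow v.1 v.2 := by
    rw [← hins, filter_lt_insert]; rfl
  have hcu := card_range_sdiff u.1 u.2
  have hJ : v.2 ∈ insert κ u.1 := hins ▸ Finset.mem_insert_self _ _
  obtain ⟨M, hM1, hM2⟩ : ∃ M, u.2 < M ∧ κ < M := ⟨u.2 + κ + 1, by omega, by omega⟩
  have key1 := sum_filter_lt_le (insert κ u.1) v.2 κ
  have key2 := sum_filter_lt_le (Finset.range M \ u.1) u.2 κ
  have split := sum_range_sdiff_add (fun x => 2 * (κ : ℤ) - 1 - 2 * x) u.1 κ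
  rw [sum_range_sdiff_eq _ hM2.le, ← filter_lt_insert u.1 κ] at split
  have tot : ∑ x ∈ Finset.range κ, (2 * (κ : ℤ) - 1 - 2 * x) = κ ^ 2 := by
    rw [Finset.sum_sub_distrib, ← Finset.mul_sum, two_mul_sum_range]
    simp; ring
  have e1 : ∑ x ∈ (insert κ u.1).filter (· < v.2), (2 * (κ : ℤ) - 1 - 2 * x) =
      countBelow v.1 v.2 * (2 * κ - 1) -
        2 * ∑ x ∈ (insert κ u.1).filter (· < v.2), (x : ℤ) := by
    rw [Finset.sum_sub_distrib, ← Finset.mul_sum]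
    simp [hcv]; ring
  have e2 : ∑ x ∈ (Finset.range M \ u.1).filter (· < u.2), (2 * (κ : ℤ) - 1 - 2 * x) =
      (u.2 - countBelow u.1 u.2) * (2 * κ - 1) -
        2 * ∑ x ∈ Finset.range u.2 \ u.1, (x : ℤ) := by
    rw [← sum_range_sdiff_eq _ hM1.le, Finset.sum_sub_distrib, ← Finset.mul_sum]
    simp [hcu]; ring
  have hpu : potential u = ∑ x ∈ u.1, (x : ℤ) ^ 2 + 2 * ∑ x ∈ Finset.range u.2 \ u.1, (x : ℤ) +
    (u.2 - countBelow u.1 u.2 : ℤ) := rfl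
  have hprod : (κ : ℤ) * (2 * κ - 1) = countBelow v.1 v.2 * (2 * κ - 1) +
      (u.2 - countBelow u.1 u.2) * (2 * κ - 1) := by
    rw [← add_mul, ← hsum]
  refine ⟨by linarith, fun heq => ?_⟩
  have hvκ : v.2 = κ := by
    by_contra hne
    have := sum_filter_lt_lt hJ (Finset.mem_insert_self κ u.1) hne
    linarith
  have huκ : u.2 = κ := by
    by_contra hne
    have := sum_filter_lt_lt (A := Finset.range M \ u.1) (k := u.2) (κ := κ)
      (by simp [hM1, hu]) (by simp [hM2, hκ]) hne
    linarith
  refine Prod.ext ?_ (huκ.trans hvκ.symm)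
  rw [← Finset.erase_insert hκ, ← hins, ← hvκ, Finset.erase_insert hv]

theorem det_ne_zero_of_potential {ι : Type*} [Fintype ι] [DecidableEq ι] (M : Matrix ι ι ℂ)
    (g : ι → ℤ) (hd : ∀ a, M a a ≠ 0)
    (h : ∀ a b, M a b ≠ 0 → g a ≤ g b ∧ (g a = g b → a = b)) : M.det ≠ 0 := by
  intro hdet
  obtain ⟨v, hv, hMv⟩ := Matrix.exists_mulVec_eq_zero_iff.2 hdet
  obtain ⟨a, ha, hmax⟩ := Finset.exists_max_image (Finset.univ.filter fun a => v a ≠ 0) g (by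
    obtain ⟨a, ha⟩ := Function.ne_iff.1 hv
    exact ⟨a, by simpa using ha⟩)
  have hrow : ∑ b, M a b * v b = 0 := congrFun hMv a
  rw [Finset.sum_eq_single a] at hrow
  · exact mul_ne_zero (hd a) (Finset.mem_filter.1 ha).2 hrow
  · intro b _ hba
    by_contra hne
    obtain ⟨h1, h2⟩ := h a b (left_ne_zero_of_mul hne)
    have h3 := hmax b (by simpa using right_ne_zero_of_mul hne)
    exact hba (h2 (le_antisymm h1 h3)).symm
  · simp

/-- The `(J, I)` entry of the Koszul map `e_I ↦ ∑ k, x k • e_k ∧ e_I`. -/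
noncomputable def koszulEntry (J I : Finset ℕ) (x : ℕ → ℂ) : ℂ :=
  ∑ k ∈ J, if J.erase k = I then (-1) ^ countBelow J k * x k else 0

/-- A square matrix of values of the Koszul flattening of the family of matrices `X`. -/
noncomputable def koszulMinor {n ι : Type*} [Fintype n] (J I : ι → Finset ℕ) (α β : ι → n → ℂ)
    (X : ℕ → Matrix n n ℂ) : Matrix ι ι ℂ :=
  Matrix.of fun a b => koszulEntry (J a) (I b) fun k => α a ⬝ᵥ (X k).mulVec (β b)

/-- The set `W` contains a family of `2N + 1` matrices whose Koszul flattening has rank at least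
`R`, witnessed by a nonvanishing minor in suitable bases. -/
def HasKoszulMinor (N R : ℕ) (W : Set (Matrix (Fin (N + 1)) (Fin (N + 1)) ℂ)) : Prop :=
  ∃ (ι : Type) (_ : Fintype ι) (_ : DecidableEq ι) (J I : ι → Finset ℕ)
    (α β : ι → Fin (N + 1) → ℂ) (X : ℕ → Matrix (Fin (N + 1)) (Fin (N + 1)) ℂ),
    (∀ a, J a ⊆ Finset.range (2 * N + 1)) ∧
    (∀ a, I a ∈ (Finset.range (2 * N + 1)).powersetCard N) ∧
    R ≤ Fintype.card ι ∧ (∀ k, X k ∈ W) ∧ (koszulMinor J I α β X).det ≠ 0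

/-- The row of the box attached to a pair `(I, k)`. -/
def boxRow (N : ℕ) (u : Finset ℕ × ℕ) : Fin (N + 1) := Fin.ofNat (N + 1) (countBelow u.1 u.2)

/-- The column of the box attached to a pair `(I, k)`. -/
def boxCol (N : ℕ) (u : Finset ℕ × ℕ) : Fin (N + 1) :=
  Fin.ofNat (N + 1) (u.2 - countBelow u.1 u.2)

theorem boxRow_val {N : ℕ} {u : Finset ℕ × ℕ} (hu : u ∈ koszulPairs N) :
    (boxRow N u : ℕ) = countBelow u.1 u.2 :=
  Nat.mod_eq_of_lt (Nat.lt_succ_of_le (countBelow_le_of_mem hu))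

theorem boxCol_val {N : ℕ} {u : Finset ℕ × ℕ} (hu : u ∈ koszulPairs N) :
    (boxCol N u : ℕ) = u.2 - countBelow u.1 u.2 :=
  Nat.mod_eq_of_lt (Nat.lt_succ_of_le (sub_countBelow_le_of_mem hu))

theorem card_filter_box_mem_le (N c : ℕ) (S : Finset (Fin (N + 1) × Fin (N + 1)))
    (hS : ∀ b ∈ S, ∀ b' : Fin (N + 1) × Fin (N + 1), b'.1 ≤ b.1 → b.2 ≤ b'.2 → b' ∈ S)
    (hc : S.card ≤ c) :
    ((koszulPairs N).filter fun u => (boxRow N u, boxCol N u) ∈ S).card ≤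
      (N + c).choose (N + 1) := by
  rw [Finset.card_eq_sum_card_fiberwise
    (s := (koszulPairs N).filter fun u => (boxRow N u, boxCol N u) ∈ S)
    (f := fun u => (boxRow N u, boxCol N u)) (t := S) (fun u hu => (Finset.mem_filter.1 hu).2)]
  set e : Fin (N + 1) × Fin (N + 1) → ℕ × ℕ := fun b => (b.1, N - b.2) with he
  have hinj : Set.InjOn e S := by
    intro b _ b' _ h
    simp only [he, Prod.mk.injEq] at h
    exact Prod.ext (Fin.ext h.1) (Fin.ext (by have := b.2.is_le; have := b'.2.is_le; omega))
  have hsum := sum_rectangle_le (N := N) S.card (S.image e) (Finset.card_image_of_injOn hinj) (by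
    simp only [Finset.mem_image]
    rintro _ ⟨b, hb, rfl⟩ ⟨x, y⟩ hxy
    simp only [he, Prod.mk_le_mk] at hxy
    have hb1 := b.1.is_le
    have hb2 := b.2.is_le
    refine ⟨(⟨x, by omega⟩, ⟨N - y, by omega⟩), hS b hb _ ?_ ?_, ?_⟩
    · exact hxy.1
    · rw [Fin.le_def]; simp only; omega
    · simp only [he, Prod.mk.injEq, true_and]; omega)
  rw [Finset.sum_image hinj] at hsum
  refine le_trans (Finset.sum_le_sum fun b _ => ?_)
    (hsum.trans (Nat.choose_le_choose _ (by omega)))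
  refine le_trans (Finset.card_le_card ?_)
    (card_filter_koszulPairs_le N b.1 (N - b.2) b.1.is_le (Nat.sub_le _ _))
  intro u hu
  simp only [Finset.mem_filter] at hu ⊢
  obtain ⟨⟨hu, _⟩, rfl⟩ := hu
  rw [boxRow_val hu, boxCol_val hu]
  have := sub_countBelow_le_of_mem hu
  exact ⟨hu, rfl, by omega⟩

theorem hasKoszulMinor_of_corner (N c : ℕ) (S : Finset (Fin (N + 1) × Fin (N + 1)))
    (hS : ∀ b ∈ S, ∀ b' : Fin (N + 1) × Fin (N + 1), b'.1 ≤ b.1 → b.2 ≤ b'.2 → b' ∈ S)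
    (hc : S.card ≤ c) :
    HasKoszulMinor N ((N + 1) * (2 * N + 1).choose N - (N + c).choose (N + 1))
      {X | ∀ b ∈ S, X b.1 b.2 = 0} := by
  classical
  set U := (koszulPairs N).filter fun u => (boxRow N u, boxCol N u) ∉ S with hU
  set X : ℕ → Matrix (Fin (N + 1)) (Fin (N + 1)) ℂ :=
    fun k => Matrix.of fun i j => if (i : ℕ) + j = k ∧ (i, j) ∉ S then 1 else 0 with hX
  have hmem (u : U) : u.1 ∈ koszulPairs N := (Finset.mem_filter.1 u.2).1
  refine ⟨U, inferInstance, inferInstance, fun u => insert u.1.2 u.1.1, fun u => u.1.1,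
    fun u => Pi.single (boxRow N u) 1, fun u => Pi.single (boxCol N u) 1, X, ?_, ?_, ?_, ?_, ?_⟩
  · intro u
    obtain ⟨h1, h2, h3, h4⟩ := mem_koszulPairs.1 (hmem u)
    exact Finset.insert_subset (Finset.mem_range.2 h3) h1
  · intro u
    obtain ⟨h1, h2, h3, h4⟩ := mem_koszulPairs.1 (hmem u)
    exact Finset.mem_powersetCard.2 ⟨h1, h2⟩
  · rw [Fintype.card_coe, ← card_koszulPairs]
    have h1 : ((koszulPairs N).filter fun u => (boxRow N u, boxCol N u) ∈ S).card + U.card =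
        (koszulPairs N).card := Finset.card_filter_add_card_filter_not _
    have h2 := card_filter_box_mem_le N c S hS hc
    omega
  · intro k b hb
    simp [hX, hb]
  · refine det_ne_zero_of_potential _ (fun u => potential u.1) ?_ ?_
    · intro u
      obtain ⟨h1, h2, h3, h4⟩ := mem_koszulPairs.1 (hmem u)
      have h5 := countBelow_le u.1.1 u.1.2
      have h6 := (Finset.mem_filter.1 u.2).2
      simp only [koszulMinor, koszulEntry, Matrix.of_apply]
      rw [Finset.sum_eq_single u.1.2]
      · rw [if_pos (Finset.erase_insert h4)]
        refine mul_ne_zero (pow_ne_zero _ (by norm_num)) ?_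
        simp only [hX, Matrix.mulVec_single_one, single_one_dotProduct, Matrix.col_apply,
          Matrix.of_apply]
        have h7 : (boxRow N u : ℕ) + boxCol N u = u.1.2 := by
          rw [boxRow_val (hmem u), boxCol_val (hmem u)]; omega
        rw [if_pos ⟨h7, h6⟩]
        exact one_ne_zero
      · intro k hk hne
        rw [if_neg]
        intro h
        have : u.1.2 ∈ (insert u.1.2 u.1.1).erase k :=
          Finset.mem_erase.2 ⟨hne.symm, Finset.mem_insert_self _ _⟩
        rw [h] at this
        exact h4 this
      · intro h
        exact absurd (Finset.mem_insert_self _ _) h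
    · intro v u hne
      simp only [koszulMinor, koszulEntry, Matrix.of_apply] at hne
      obtain ⟨κ, hκ, hne⟩ := Finset.exists_ne_zero_of_sum_ne_zero hne
      have herase : (insert v.1.2 v.1.1).erase κ = u.1.1 := by
        by_contra h
        exact hne (if_neg h)
      rw [if_pos herase] at hne
      have hne := right_ne_zero_of_mul hne
      simp only [hX, Matrix.mulVec_single_one, single_one_dotProduct, Matrix.col_apply,
        Matrix.of_apply] at hne
      have hsum : (boxRow N v.1 : ℕ) + boxCol N u.1 = κ := by
        by_contra h
        exact hne (if_neg fun h' => h h'.1)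
      rw [boxRow_val (hmem v), boxCol_val (hmem u)] at hsum
      have h5 := countBelow_le u.1.1 u.1.2
      have := potential_le (u := u.1) (v := v.1) (κ := κ) (mem_koszulPairs.1 (hmem u)).2.2.2
        (mem_koszulPairs.1 (hmem v)).2.2.2 (by rw [← herase]; simp)
        (by rw [← herase, Finset.insert_erase hκ]) (by omega)
      exact ⟨this.1, fun h => (Subtype.ext (this.2 h)).symm⟩

theorem koszulEntry_tendsto {γ : Type*} {l : Filter γ} (J I : Finset ℕ) {f : γ → ℕ → ℂ}
    {x : ℕ → ℂ} (h : ∀ k ∈ J, Tendsto (fun t => f t k) l (nhds (x k))) :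
    Tendsto (fun t => koszulEntry J I (f t)) l (nhds (koszulEntry J I x)) := by
  refine tendsto_finsetSum _ fun k hk => ?_
  split_ifs
  · exact (h k hk).const_mul _
  · exact tendsto_const_nhds

theorem Matrix.tendsto_det {γ ι : Type*} [Fintype ι] [DecidableEq ι] {l : Filter γ}
    {M : γ → Matrix ι ι ℂ} {A : Matrix ι ι ℂ}
    (h : ∀ a b, Tendsto (fun t => M t a b) l (nhds (A a b))) :
    Tendsto (fun t => (M t).det) l (nhds A.det) :=
  ((continuous_id.matrix_det).tendsto A).comp
    (tendsto_pi_nhds.2 fun a => tendsto_pi_nhds.2 fun b => h a b)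

theorem koszulMinor_det_tendsto {γ n ι : Type*} [Fintype n] [Fintype ι] [DecidableEq ι]
    {l : Filter γ} (J I : ι → Finset ℕ) (α β : ι → n → ℂ) {Y : γ → ℕ → Matrix n n ℂ}
    {X : ℕ → Matrix n n ℂ} (h : ∀ k, Tendsto (fun t => Y t k) l (nhds (X k))) :
    Tendsto (fun t => (koszulMinor J I α β (Y t)).det) l
      (nhds (koszulMinor J I α β X).det) := by
  refine Matrix.tendsto_det fun a b => koszulEntry_tendsto _ _ fun k _ => ?_
  have hc : Continuous fun Z : Matrix n n ℂ => α a ⬝ᵥ Z.mulVec (β b) := by fun_prop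
  exact (hc.tendsto (X k)).comp (h k)

/-- Semicontinuity: if every element of `W'` is a limit of elements of `W` up to simultaneous
changes of bases, then a nonvanishing Koszul minor on `W'` yields one on `W`. -/
theorem HasKoszulMinor.of_degeneration {N R : ℕ}
    {W W' : Set (Matrix (Fin (N + 1)) (Fin (N + 1)) ℂ)} (hW' : HasKoszulMinor N R W')
    (P Q : ℂ → Matrix (Fin (N + 1)) (Fin (N + 1)) ℂ)
    (γ : Matrix (Fin (N + 1)) (Fin (N + 1)) ℂ → ℂ → Matrix (Fin (N + 1)) (Fin (N + 1)) ℂ)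
    (hγ : ∀ Y ∈ W', Tendsto (γ Y) (nhdsWithin 0 {0}ᶜ) (nhds Y))
    (hW : ∀ Y ∈ W', ∀ t ≠ 0, ∃ Z ∈ W, γ Y t = P t * Z * Q t) : HasKoszulMinor N R W := by
  obtain ⟨ι, _, _, J, I, α, β, X, hJ, hI, hR, hX, hdet⟩ := hW'
  have hlim := koszulMinor_det_tendsto J I α β (Y := fun t k => γ (X k) t)
    fun k => hγ (X k) (hX k)
  obtain ⟨t, ht, ht0⟩ := ((hlim.eventually_ne hdet).and self_mem_nhdsWithin).exists
  choose Z hZ hγZ using fun k => hW (X k) (hX k) t ht0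
  refine ⟨ι, inferInstance, inferInstance, J, I, fun a => Matrix.vecMul (α a) (P t),
    fun b => (Q t).mulVec (β b), Z, hJ, hI, hR, hZ, ?_⟩
  convert ht using 2
  ext a b
  simp only [koszulMinor, Matrix.of_apply, hγZ]
  congr 1
  ext k
  rw [← Matrix.dotProduct_mulVec, Matrix.mulVec_mulVec, Matrix.mulVec_mulVec]

theorem HasKoszulMinor.of_shift_row {N R : ℕ} (S : Finset (Fin (N + 1) × Fin (N + 1)))
    {p q : Fin (N + 1)} (hpq : p ≠ q)
    (h : HasKoszulMinor N R {X | ∀ b : Fin (N + 1) × Fin (N + 1),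
      ((b ∈ S ∧ (b.1 = q → (p, b.2) ∈ S)) ∨ (b.1 = p ∧ (q, b.2) ∈ S)) → X b.1 b.2 = 0}) :
    HasKoszulMinor N R {X | ∀ b ∈ S, X b.1 b.2 = 0} := by
  classical
  refine h.of_degeneration (fun t => 1 + Matrix.single q p t⁻¹) (fun _ => 1)
    (fun Y t => Matrix.of fun i j =>
      if i = p ∧ (q, j) ∈ S ∧ (p, j) ∉ S then t * Y q j else Y i j) ?_ ?_
  · intro Y hY
    refine tendsto_pi_nhds.2 fun i => tendsto_pi_nhds.2 fun j => ?_
    simp only [Matrix.of_apply]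
    split_ifs with hc
    · have : Y i j = 0 := hY (i, j) (Or.inr ⟨hc.1, hc.2.1⟩)
      rw [this]
      have hc' : Continuous fun t : ℂ => t * Y q j := by fun_prop
      simpa using (hc'.tendsto 0).mono_left nhdsWithin_le_nhds
    · exact tendsto_const_nhds
  · intro Y hY t ht
    set G : Matrix (Fin (N + 1)) (Fin (N + 1)) ℂ := Matrix.of fun i j =>
      if i = p ∧ (q, j) ∈ S ∧ (p, j) ∉ S then t * Y q j else Y i j with hG
    have hinv : (1 + Matrix.single q p t⁻¹) * (1 - Matrix.single q p t⁻¹) =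
        (1 : Matrix (Fin (N + 1)) (Fin (N + 1)) ℂ) := by
      have : Matrix.single q p t⁻¹ * Matrix.single q p t⁻¹ =
        (0 : Matrix (Fin (N + 1)) (Fin (N + 1)) ℂ) := Matrix.single_mul_single_of_ne _ _ _ _ hpq _
      noncomm_ring [this]
    refine ⟨(1 - Matrix.single q p t⁻¹) * G, ?_, ?_⟩
    · rintro ⟨i, j⟩ hb
      simp only [Matrix.sub_mul, Matrix.one_mul, Matrix.sub_apply]
      have hY' := hY (i, j)
      by_cases hi : i = q
      · subst hi
        rw [Matrix.single_mul_apply_same]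
        have hpj := hY (p, j)
        simp only [hG, Matrix.of_apply]
        simp only at hb hY' hpj ⊢
        by_cases hp : (p, j) ∈ S
        · have h1 := hY' (Or.inl ⟨hb, fun _ => hp⟩)
          have h2 := hpj (Or.inr ⟨trivial, hb⟩)
          simp [hp, h1, h2]
        · have : i ≠ p := fun h => hpq h.symm
          simp [hp, hb, this, ht]
      · rw [Matrix.single_mul_apply_of_ne _ _ _ _ _ hi]
        simp only [hG, Matrix.of_apply, sub_zero]
        rw [if_neg]
        · exact hY' (Or.inl ⟨hb, fun h => absurd h hi⟩)
        · rintro ⟨rfl, _, h3⟩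
          exact h3 hb
    · rw [Matrix.mul_one, ← Matrix.mul_assoc, hinv, Matrix.one_mul]

theorem HasKoszulMinor.of_shift_col {N R : ℕ} (S : Finset (Fin (N + 1) × Fin (N + 1)))
    {p q : Fin (N + 1)} (hpq : p ≠ q)
    (h : HasKoszulMinor N R {X | ∀ b : Fin (N + 1) × Fin (N + 1),
      ((b ∈ S ∧ (b.2 = q → (b.1, p) ∈ S)) ∨ (b.2 = p ∧ (b.1, q) ∈ S)) → X b.1 b.2 = 0}) :
    HasKoszulMinor N R {X | ∀ b ∈ S, X b.1 b.2 = 0} := by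
  classical
  refine h.of_degeneration (fun _ => 1) (fun t => 1 + Matrix.single p q t⁻¹)
    (fun Y t => Matrix.of fun i j =>
      if j = p ∧ (i, q) ∈ S ∧ (i, p) ∉ S then t * Y i q else Y i j) ?_ ?_
  · intro Y hY
    refine tendsto_pi_nhds.2 fun i => tendsto_pi_nhds.2 fun j => ?_
    simp only [Matrix.of_apply]
    split_ifs with hc
    · have : Y i j = 0 := hY (i, j) (Or.inr ⟨hc.1, hc.2.1⟩)
      rw [this]
      have hc' : Continuous fun t : ℂ => t * Y i q := by fun_prop
      simpa using (hc'.tendsto 0).mono_left nhdsWithin_le_nhds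
    · exact tendsto_const_nhds
  · intro Y hY t ht
    set G : Matrix (Fin (N + 1)) (Fin (N + 1)) ℂ := Matrix.of fun i j =>
      if j = p ∧ (i, q) ∈ S ∧ (i, p) ∉ S then t * Y i q else Y i j with hG
    have hinv : (1 - Matrix.single p q t⁻¹) * (1 + Matrix.single p q t⁻¹) =
        (1 : Matrix (Fin (N + 1)) (Fin (N + 1)) ℂ) := by
      have : Matrix.single p q t⁻¹ * Matrix.single p q t⁻¹ =
        (0 : Matrix (Fin (N + 1)) (Fin (N + 1)) ℂ) :=
          Matrix.single_mul_single_of_ne _ _ _ _ hpq.symm _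
      noncomm_ring [this]
    refine ⟨G * (1 - Matrix.single p q t⁻¹), ?_, ?_⟩
    · rintro ⟨i, j⟩ hb
      simp only [Matrix.mul_sub, Matrix.mul_one, Matrix.sub_apply]
      have hY' := hY (i, j)
      by_cases hj : j = q
      · subst hj
        rw [Matrix.mul_single_apply_same]
        have hpj := hY (i, p)
        simp only [hG, Matrix.of_apply]
        simp only at hb hY' hpj ⊢
        by_cases hp : (i, p) ∈ S
        · have h1 := hY' (Or.inl ⟨hb, fun _ => hp⟩)
          have h2 := hpj (Or.inr ⟨trivial, hb⟩)
          simp [hp, h1, h2]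
        · have : j ≠ p := fun h => hpq h.symm
          have h3 : t * Y i j * t⁻¹ = Y i j := by field_simp
          simp [hp, hb, this, h3]
      · rw [Matrix.mul_single_apply_of_ne _ _ _ _ _ hj]
        simp only [hG, Matrix.of_apply, sub_zero]
        rw [if_neg]
        · exact hY' (Or.inl ⟨hb, fun h => absurd h hj⟩)
        · rintro ⟨rfl, _, h3⟩
          exact h3 hb
    · rw [Matrix.one_mul, Matrix.mul_assoc, hinv, Matrix.mul_one]

theorem HasKoszulMinor.mono {N R : ℕ} {W W' : Set (Matrix (Fin (N + 1)) (Fin (N + 1)) ℂ)}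
    (h : HasKoszulMinor N R W) (hW : W ⊆ W') : HasKoszulMinor N R W' := by
  obtain ⟨ι, i₁, i₂, J, I, α, β, X, hJ, hI, hR, hX, hdet⟩ := h
  exact ⟨ι, i₁, i₂, J, I, α, β, X, hJ, hI, hR, fun k => hW (hX k), hdet⟩

theorem Finset.sum_image_lt {α : Type*} [DecidableEq α] (S : Finset α) (φ : α → α) (f : α → ℕ)
    (hle : ∀ b ∈ S, f (φ b) ≤ f b) (hlt : ∃ b ∈ S, f (φ b) < f b) :
    ∑ b ∈ S.image φ, f b < ∑ b ∈ S, f b :=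
  lt_of_le_of_lt (Finset.sum_image_le_of_nonneg fun _ _ => Nat.zero_le _)
    (Finset.sum_lt_sum hle hlt)

/-- The space of matrices vanishing on any `c` boxes has a large Koszul minor: shifting the boxes
to a corner is a degeneration. -/
theorem hasKoszulMinor_of_card_le (N c : ℕ) (S : Finset (Fin (N + 1) × Fin (N + 1)))
    (hc : S.card ≤ c) :
    HasKoszulMinor N ((N + 1) * (2 * N + 1).choose N - (N + c).choose (N + 1))
      {X | ∀ b ∈ S, X b.1 b.2 = 0} := by
  classical
  set f : Fin (N + 1) × Fin (N + 1) → ℕ := fun b => b.1 + (N - b.2) with hf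
  induction hn : ∑ b ∈ S, f b using Nat.strong_induction_on generalizing S with
  | _ n ih =>
    subst hn
    by_cases hrow : ∃ p q j, p < q ∧ (q, j) ∈ S ∧ (p, j) ∉ S
    · obtain ⟨p, q, j, hpq, hq, hp⟩ := hrow
      refine HasKoszulMinor.of_shift_row S hpq.ne ?_
      set φ : Fin (N + 1) × Fin (N + 1) → Fin (N + 1) × Fin (N + 1) :=
        fun b => if b.1 = q ∧ (p, b.2) ∉ S then (p, b.2) else b with hφ
      refine (ih _ (Finset.sum_image_lt S φ f ?_ ⟨(q, j), hq, ?_⟩) (S.image φ)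
        (Finset.card_image_le.trans hc) rfl).mono ?_
      · intro b _
        simp only [hφ]
        split_ifs with h
        · simp only [hf, h.1]
          have : (p : ℕ) < q := hpq
          omega
        · exact le_rfl
      · simp only [hφ, hf, hp, not_false_eq_true, and_self, if_true]
        have : (p : ℕ) < q := hpq
        omega
      · rintro X hX ⟨i, k⟩ hb
        refine hX _ (Finset.mem_image.2 ?_)
        by_cases h : (i, k) ∈ S ∧ (i = q → (p, k) ∈ S)
        · exact ⟨(i, k), h.1, if_neg fun h' => h'.2 (h.2 h'.1)⟩
        · obtain ⟨rfl, h2⟩ := hb.resolve_left h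
          refine ⟨(q, k), h2, if_pos ⟨rfl, fun h3 => h ⟨h3, fun h4 => absurd h4 hpq.ne⟩⟩⟩
    by_cases hcol : ∃ p q i, q < p ∧ (i, q) ∈ S ∧ (i, p) ∉ S
    · obtain ⟨p, q, i, hpq, hq, hp⟩ := hcol
      refine HasKoszulMinor.of_shift_col S hpq.ne' ?_
      set φ : Fin (N + 1) × Fin (N + 1) → Fin (N + 1) × Fin (N + 1) :=
        fun b => if b.2 = q ∧ (b.1, p) ∉ S then (b.1, p) else b with hφ
      have hlt : (q : ℕ) < p := hpq
      have hple := p.is_le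
      refine (ih _ (Finset.sum_image_lt S φ f ?_ ⟨(i, q), hq, ?_⟩) (S.image φ)
        (Finset.card_image_le.trans hc) rfl).mono ?_
      · intro b _
        simp only [hφ]
        split_ifs with h
        · simp only [hf, h.1]
          omega
        · exact le_rfl
      · simp only [hφ, hf, hp, not_false_eq_true, and_self, if_true]
        omega
      · rintro X hX ⟨k, j⟩ hb
        refine hX _ (Finset.mem_image.2 ?_)
        by_cases h : (k, j) ∈ S ∧ (j = q → (k, p) ∈ S)
        · exact ⟨(k, j), h.1, if_neg fun h' => h'.2 (h.2 h'.1)⟩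
        · obtain ⟨rfl, h2⟩ := hb.resolve_left h
          refine ⟨(k, q), h2, if_pos ⟨rfl, fun h3 => h ⟨h3, fun h4 => absurd h4 hpq.ne'⟩⟩⟩
    push Not at hrow hcol
    refine hasKoszulMinor_of_corner N c S ?_ hc
    rintro ⟨i, j⟩ hb ⟨i', j'⟩ hi hj
    simp only at hi hj
    have h1 : (i', j) ∈ S := by
      rcases hi.eq_or_lt with rfl | hi
      · exact hb
      · exact hrow _ _ _ hi hb
    rcases hj.eq_or_lt with rfl | hj
    · exact h1
    · exact hcol _ _ _ hj h1

/-- Every linear space of matrices of codimension at most `c` has a large Koszul minor: a generic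
torus degeneration takes it to a coordinate subspace. -/
theorem Submodule.hasKoszulMinor (N c : ℕ)
    (W : Submodule ℂ (Matrix (Fin (N + 1)) (Fin (N + 1)) ℂ))
    (hW : (N + 1) ^ 2 ≤ Module.finrank ℂ W + c) :
    HasKoszulMinor N ((N + 1) * (2 * N + 1).choose N - (N + c).choose (N + 1))
      (W : Set (Matrix (Fin (N + 1)) (Fin (N + 1)) ℂ)) := by
  classical
  set wt : Fin (N + 1) × Fin (N + 1) → ℕ := fun b => b.1 * (N + 1) + b.2 with hwt
  have hwt_inj : Function.Injective wt := by
    intro b b' h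
    have h1 := b.2.2
    have h2 := b'.2.2
    have h3 : (b.1 : ℕ) = b'.1 := by
      have := congrArg (· / (N + 1)) h
      simpa [hwt, Nat.add_div_of_dvd_right, Nat.div_eq_of_lt h1, Nat.div_eq_of_lt h2] using this
    have h4 : (b.2 : ℕ) = b'.2 := by
      simp only [hwt, h3] at h
      omega
    exact Prod.ext (Fin.ext h3) (Fin.ext h4)
  set L : Fin (N + 1) × Fin (N + 1) → Matrix (Fin (N + 1)) (Fin (N + 1)) ℂ → Prop :=
    fun b f => f ∈ W ∧ f b.1 b.2 = 1 ∧ ∀ b', wt b < wt b' → f b'.1 b'.2 = 0 with hL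
  set R : Finset (Fin (N + 1) × Fin (N + 1)) := Finset.univ.filter fun b => ∃ f, L b f with hR
  have hex (b : Fin (N + 1) × Fin (N + 1)) : ∃ f, b ∈ R → L b f := by
    by_cases h : b ∈ R
    · obtain ⟨f, hf⟩ := (Finset.mem_filter.1 h).2
      exact ⟨f, fun _ => hf⟩
    · exact ⟨0, fun h' => absurd h' h⟩
  choose f hf using hex
  have hcard : Module.finrank ℂ W ≤ R.card := by
    set res : W →ₗ[ℂ] (R → ℂ) :=
      { toFun := fun g b => g.1 b.1.1 b.1.2
        map_add' := fun _ _ => rfl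
        map_smul' := fun _ _ => rfl } with hres
    have hinj : Function.Injective res := by
      rw [← LinearMap.ker_eq_bot, LinearMap.ker_eq_bot']
      intro g hg
      by_contra hne
      have hne' : ∃ b : Fin (N + 1) × Fin (N + 1), g.1 b.1 b.2 ≠ 0 := by
        by_contra! h
        exact hne (Subtype.ext (Matrix.ext fun i j => h (i, j)))
      obtain ⟨b, hb, hmax⟩ := Finset.exists_max_image
        (Finset.univ.filter fun b : Fin (N + 1) × Fin (N + 1) => g.1 b.1 b.2 ≠ 0) wt
        (by obtain ⟨b, hb⟩ := hne'; exact ⟨b, by simpa using hb⟩)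
      have hb := (Finset.mem_filter.1 hb).2
      have hbR : b ∈ R := by
        refine Finset.mem_filter.2 ⟨Finset.mem_univ _, (g.1 b.1 b.2)⁻¹ • g.1,
          W.smul_mem _ g.2, ?_, ?_⟩
        · simp [hb]
        · intro b' hb'
          have : g.1 b'.1 b'.2 = 0 := by
            by_contra h
            exact absurd (hmax b' (by simpa using h)) (not_le.2 hb')
          simp [this]
      exact hb (congrFun hg ⟨b, hbR⟩)
    simpa using LinearMap.finrank_le_finrank_of_injective hinj
  have hS : Rᶜ.card ≤ c := by
    rw [Finset.card_compl]
    simp only [Fintype.card_prod, Fintype.card_fin]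
    have : (N + 1) * (N + 1) = (N + 1) ^ 2 := (sq _).symm
    omega
  refine (hasKoszulMinor_of_card_le N c Rᶜ hS).of_degeneration
    (fun t => Matrix.diagonal fun i => (t ^ ((i : ℕ) * (N + 1)))⁻¹)
    (fun t => Matrix.diagonal fun j => (t ^ (j : ℕ))⁻¹)
    (fun Y t => Matrix.of fun i j =>
      ∑ b ∈ R, Y b.1 b.2 * t ^ (wt b - wt (i, j)) * f b i j) ?_ ?_
  · intro Y hY
    refine tendsto_pi_nhds.2 fun i => tendsto_pi_nhds.2 fun j => ?_
    have hc : Continuous fun t : ℂ => ∑ b ∈ R, Y b.1 b.2 * t ^ (wt b - wt (i, j)) * f b i j := by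
      fun_prop
    have h0 : ∑ b ∈ R, Y b.1 b.2 * (0 : ℂ) ^ (wt b - wt (i, j)) * f b i j = Y i j := by
      have hz : ∀ b ∈ R, b ≠ (i, j) →
          Y b.1 b.2 * (0 : ℂ) ^ (wt b - wt (i, j)) * f b i j = 0 := by
        intro b hb hne
        rcases lt_or_ge (wt b) (wt (i, j)) with h | h
        · rw [(hf b hb).2.2 _ h, mul_zero]
        · have : wt (i, j) ≠ wt b := fun h => hne (hwt_inj h).symm
          rw [zero_pow (by omega)]
          ring
      by_cases hij : (i, j) ∈ R
      · rw [Finset.sum_eq_single_of_mem _ hij hz, (hf _ hij).2.1]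
        simp
      · rw [Finset.sum_eq_zero fun b hb => hz b hb fun h => hij (h ▸ hb)]
        exact (hY (i, j) (Finset.mem_compl.2 hij)).symm
    have := (hc.tendsto 0).mono_left (nhdsWithin_le_nhds (s := {0}ᶜ))
    rwa [h0] at this
  · intro Y _ t ht
    refine ⟨∑ b ∈ R, (Y b.1 b.2 * t ^ wt b) • f b,
      W.sum_mem fun b hb => W.smul_mem _ (hf b hb).1, ?_⟩
    ext i j
    rw [Matrix.mul_diagonal, Matrix.diagonal_mul, Matrix.sum_apply, Finset.mul_sum,
      Finset.sum_mul, Matrix.of_apply]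
    refine Finset.sum_congr rfl fun b hb => ?_
    rw [Matrix.smul_apply, smul_eq_mul]
    rcases lt_or_ge (wt b) (wt (i, j)) with h | h
    · rw [(hf b hb).2.2 _ h]
      ring
    · rw [pow_sub₀ t ht h]
      simp only [hwt, pow_add t ((i : ℕ) * (N + 1)), mul_inv]
      ring

theorem card_le_card_of_factorization {ι κ : Type*} [Fintype ι] [DecidableEq ι] [Fintype κ]
    (M : Matrix ι ι ℂ) (hM : M.det ≠ 0) (A : Matrix ι κ ℂ) (B : Matrix κ ι ℂ) (h : M = A * B) :
    Fintype.card ι ≤ Fintype.card κ := by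
  rw [← Matrix.rank_of_isUnit M ((Matrix.isUnit_iff_isUnit_det M).2 hM.isUnit), h]
  exact (Matrix.rank_mul_le_left A B).trans A.rank_le_card_width

theorem countBelow_insert {H : Finset ℕ} {k : ℕ} (hk : k ∉ H) (j : ℕ) :
    countBelow (insert k H) j = countBelow H j + if k < j then 1 else 0 := by
  unfold countBelow
  rw [Finset.filter_insert]
  split_ifs with h
  · rw [Finset.card_insert_of_notMem fun h' => hk (Finset.mem_filter.1 h').1]
  · rfl

theorem countBelow_insert_self (H : Finset ℕ) (j : ℕ) :
    countBelow (insert j H) j = countBelow H j := by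
  simp [countBelow, Finset.filter_insert]

/-- The Koszul map of a fixed vector squares to zero. -/
theorem sum_koszulEntry_insert (n : ℕ) (u : ℕ → ℂ) (H J : Finset ℕ) (hJ : J ⊆ Finset.range n) :
    ∑ k ∈ Finset.range n \ H, (-1) ^ countBelow H k * u k * koszulEntry J (insert k H) u = 0 := by
  classical
  set F : ℕ → ℕ → ℂ := fun k j =>
    if k ∉ H ∧ j ∈ J ∧ J.erase j = insert k H then
      (-1) ^ (countBelow H k + countBelow J j) * (u k * u j) else 0 with hF
  have hsum : ∑ k ∈ Finset.range n \ H,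
      (-1) ^ countBelow H k * u k * koszulEntry J (insert k H) u =
      ∑ k ∈ Finset.range n, ∑ j ∈ Finset.range n, F k j := by
    rw [← Finset.sum_subset (f := fun k => ∑ j ∈ Finset.range n, F k j)
      (Finset.sdiff_subset (s := Finset.range n) (t := H))]
    · refine Finset.sum_congr rfl fun k hk => ?_
      rw [← Finset.sum_subset hJ, koszulEntry, Finset.mul_sum]
      · refine Finset.sum_congr rfl fun j hj => ?_
        simp only [hF, (Finset.mem_sdiff.1 hk).2, hj, not_false_eq_true, true_and]
        split_ifs
        · rw [pow_add]; ring
        · ring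
      · intro j _ hj
        exact if_neg fun h => hj h.2.1
    · intro k hk hk'
      refine Finset.sum_eq_zero fun j _ => if_neg fun h => hk' ?_
      exact Finset.mem_sdiff.2 ⟨hk, h.1⟩
  have hcond (k j : ℕ) : (k ∉ H ∧ j ∈ J ∧ J.erase j = insert k H) ↔
      k ∉ H ∧ j ∉ H ∧ j ≠ k ∧ J = insert j (insert k H) := by
    constructor
    · rintro ⟨hk, hj, h⟩
      have h1 : j ∉ insert k H := h ▸ Finset.notMem_erase j J
      rw [Finset.mem_insert, not_or] at h1
      exact ⟨hk, h1.2, h1.1, by rw [← h, Finset.insert_erase hj]⟩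
    · rintro ⟨hk, hj, hjk, rfl⟩
      exact ⟨hk, Finset.mem_insert_self _ _, Finset.erase_insert (by simp [hj, hjk])⟩
  have hanti (k j : ℕ) : F k j + F j k = 0 := by
    by_cases h : k ∉ H ∧ j ∉ H ∧ j ≠ k ∧ J = insert j (insert k H)
    · have h' : j ∉ H ∧ k ∉ H ∧ k ≠ j ∧ J = insert k (insert j H) :=
        ⟨h.2.1, h.1, h.2.2.1.symm, h.2.2.2.trans (Finset.insert_comm _ _ _)⟩
      simp only [hF]
      rw [if_pos ((hcond _ _).2 h), if_pos ((hcond _ _).2 h')]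
      have e1 : countBelow J j = countBelow H j + if k < j then 1 else 0 := by
        rw [h.2.2.2, countBelow_insert_self, countBelow_insert h.1]
      have e2 : countBelow J k = countBelow H k + if j < k then 1 else 0 := by
        rw [h'.2.2.2, countBelow_insert_self, countBelow_insert h.2.1]
      rw [e1, e2]
      rcases lt_or_gt_of_ne h.2.2.1 with hlt | hlt
      · rw [if_pos hlt, if_neg hlt.not_gt]
        ring
      · rw [if_pos hlt, if_neg hlt.not_gt]
        ring
    · have h' : ¬ (j ∉ H ∧ k ∉ H ∧ k ≠ j ∧ J = insert k (insert j H)) := fun h' =>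
        h ⟨h'.2.1, h'.1, h'.2.2.1.symm, h'.2.2.2.trans (Finset.insert_comm _ _ _)⟩
      simp only [hF]
      rw [if_neg (mt (hcond _ _).1 h), if_neg (mt (hcond _ _).1 h'), add_zero]
  rw [hsum]
  have h2 : ∑ k ∈ Finset.range n, ∑ j ∈ Finset.range n, F k j +
      ∑ k ∈ Finset.range n, ∑ j ∈ Finset.range n, F k j = 0 := by
    nth_rewrite 2 [Finset.sum_comm]
    simp_rw [← Finset.sum_add_distrib, hanti, Finset.sum_const_zero]
  exact add_self_eq_zero.1 h2

/-- The Koszul map `Λ^N ℂ^{2N+1} → Λ^{N+1} ℂ^{2N+1}` of a fixed vector has rank at most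
`(2N).choose N`. -/
theorem exists_koszulEntry_factorization (N : ℕ) (u : ℕ → ℂ) :
    ∃ (A : Finset ℕ → Fin ((2 * N).choose N) → ℂ) (B : Fin ((2 * N).choose N) → Finset ℕ → ℂ),
      ∀ J ⊆ Finset.range (2 * N + 1), ∀ I ∈ (Finset.range (2 * N + 1)).powersetCard N,
        koszulEntry J I u = ∑ i, A J i * B i I := by
  classical
  by_cases hu : ∀ k ∈ Finset.range (2 * N + 1), u k = 0
  · refine ⟨0, 0, fun J hJ I _ => ?_⟩
    simp only [Pi.zero_apply, mul_zero, Finset.sum_const_zero]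
    exact Finset.sum_eq_zero fun k hk => by simp [hu k (hJ hk)]
  push Not at hu
  obtain ⟨k₀, hk₀, hu⟩ := hu
  set T := ((Finset.range (2 * N + 1)).erase k₀).powersetCard N with hT
  have hTcard : T.card = (2 * N).choose N := by
    rw [hT, Finset.card_powersetCard, Finset.card_erase_of_mem hk₀]
    simp
  have hD (I : Finset ℕ) : ∃ D : Finset ℕ → ℂ, I ∈ (Finset.range (2 * N + 1)).powersetCard N →
      ∀ J ⊆ Finset.range (2 * N + 1),
        koszulEntry J I u = ∑ I' ∈ T, koszulEntry J I' u * D I' := by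
    by_cases hI : I ∈ (Finset.range (2 * N + 1)).powersetCard N
    swap
    · exact ⟨0, fun h => absurd h hI⟩
    obtain ⟨hI1, hI2⟩ := Finset.mem_powersetCard.1 hI
    by_cases hk : k₀ ∈ I
    swap
    · refine ⟨fun I' => if I' = I then 1 else 0, fun _ J _ => ?_⟩
      have : I ∈ T := Finset.mem_powersetCard.2
        ⟨fun x hx => Finset.mem_erase.2 ⟨fun h => hk (h ▸ hx), hI1 hx⟩, hI2⟩
      simp [this]
    · set H := I.erase k₀ with hH
      set s : ℕ → ℂ := fun k => (-1) ^ countBelow H k * u k with hs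
      have hs0 : s k₀ ≠ 0 := mul_ne_zero (pow_ne_zero _ (by norm_num)) hu
      refine ⟨fun I' => ∑ k ∈ (Finset.range (2 * N + 1) \ H).erase k₀,
        if insert k H = I' then - (s k / s k₀) else 0, fun _ J hJ => ?_⟩
      have h0 := sum_koszulEntry_insert (2 * N + 1) u H J hJ
      have hk₀' : k₀ ∈ Finset.range (2 * N + 1) \ H :=
        Finset.mem_sdiff.2 ⟨hk₀, Finset.notMem_erase _ _⟩
      rw [← Finset.add_sum_erase _ _ hk₀', hH, Finset.insert_erase hk, ← hH] at h0
      simp_rw [Finset.mul_sum]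
      rw [Finset.sum_comm]
      have h1 : ∀ k ∈ (Finset.range (2 * N + 1) \ H).erase k₀,
          ∑ I' ∈ T, koszulEntry J I' u * (if insert k H = I' then - (s k / s k₀) else 0) =
          - (s k * koszulEntry J (insert k H) u) / s k₀ := by
        intro k hk'
        obtain ⟨hk1, hk2⟩ := Finset.mem_erase.1 hk'
        obtain ⟨hk3, hk4⟩ := Finset.mem_sdiff.1 hk2
        have hmem : insert k H ∈ T := by
          refine Finset.mem_powersetCard.2 ⟨fun x hx => ?_, ?_⟩
          · rcases Finset.mem_insert.1 hx with rfl | hx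
            · exact Finset.mem_erase.2 ⟨hk1, hk3⟩
            · obtain ⟨h1, h2⟩ := Finset.mem_erase.1 hx
              exact Finset.mem_erase.2 ⟨h1, hI1 h2⟩
          · rw [Finset.card_insert_of_notMem hk4, hH, Finset.card_erase_add_one hk, hI2]
        rw [Finset.sum_eq_single_of_mem _ hmem fun I' _ hne => by rw [if_neg hne.symm, mul_zero],
          if_pos rfl]
        ring
      rw [Finset.sum_congr rfl h1, ← Finset.sum_div, Finset.sum_neg_distrib,
        eq_div_iff hs0, mul_comm]
      exact eq_neg_of_add_eq_zero_left h0
  choose D hD using hD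
  set e := T.equivFinOfCardEq hTcard with he
  refine ⟨fun J i => koszulEntry J (e.symm i).1 u, fun i I => D I (e.symm i).1,
    fun J hJ I hI => ?_⟩
  rw [hD I hI J hJ, ← Finset.sum_coe_sort T, ← e.symm.sum_comp]

/-- The common kernels of the first `c` forms of a sequence of tuples of linear forms have, along
a subsequence, convergent linearly independent families of codimension `c`. -/
theorem exists_subseq_linearIndependent_kernel {B : Type*} [Fintype B] (r c d : ℕ)
    (hd : d + c ≤ Fintype.card B) (a : ℕ → Fin r → B → ℂ) :
    ∃ (φ : ℕ → ℕ) (e : ℕ → Fin d → B → ℂ) (e' : Fin d → B → ℂ), StrictMono φ ∧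
      LinearIndependent ℂ e' ∧
      (∀ s i (ρ : Fin r), (ρ : ℕ) < c → ∑ p, a (φ s) ρ p * e s i p = 0) ∧
      ∀ i p, Tendsto (fun s => e s i p) atTop (nhds (e' i p)) := by
  classical
  have hex (s : ℕ) : ∃ f : Fin d → EuclideanSpace ℂ B, Orthonormal ℂ f ∧
      ∀ i (ρ : Fin r), (ρ : ℕ) < c → ∑ p, a s ρ p * f i p = 0 := by
    set Φ : EuclideanSpace ℂ B →ₗ[ℂ] ({ρ : Fin r // (ρ : ℕ) < c} → ℂ) :=
      { toFun := fun x ρ => ∑ p, a s ρ p * x p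
        map_add' := fun x y => by
          ext ρ
          simp [mul_add, Finset.sum_add_distrib]
        map_smul' := fun z x => by
          ext ρ
          simp only [PiLp.smul_apply, smul_eq_mul, Pi.smul_apply, RingHom.id_apply,
            Finset.mul_sum]
          exact Finset.sum_congr rfl fun p _ => by ring } with hΦ
    have h1 := LinearMap.finrank_range_add_finrank_ker Φ
    rw [finrank_euclideanSpace] at h1
    have h2 : Module.finrank ℂ (LinearMap.range Φ) ≤ c := by
      refine (Submodule.finrank_le _).trans ?_
      rw [Module.finrank_fintype_fun_eq_card]
      simpa using Fintype.card_le_of_injective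
        (fun ρ : {ρ : Fin r // (ρ : ℕ) < c} => (⟨ρ.1, ρ.2⟩ : Fin c))
        fun ρ ρ' h => Subtype.ext (Fin.ext (by simpa using h))
    have h3 : d ≤ Module.finrank ℂ (LinearMap.ker Φ) := by omega
    set b := stdOrthonormalBasis ℂ (LinearMap.ker Φ) with hb
    refine ⟨fun i => (b (Fin.castLE h3 i) : EuclideanSpace ℂ B), ?_, fun i ρ hρ => ?_⟩
    · have h4 := (b.orthonormal.comp (Fin.castLE h3) (Fin.castLE_injective h3))
      exact h4.comp_linearIsometry (LinearMap.ker Φ).subtypeₗᵢ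
    · exact congrFun (LinearMap.mem_ker.1 (b (Fin.castLE h3 i)).2) ⟨ρ, hρ⟩
  choose f hf hker using hex
  have hbd : ∀ s, f s ∈ Metric.closedBall (0 : Fin d → EuclideanSpace ℂ B) 1 := by
    intro s
    rw [mem_closedBall_zero_iff, pi_norm_le_iff_of_nonneg zero_le_one]
    exact fun i => ((hf s).1 i).le
  obtain ⟨e', -, φ, hφ, hlim⟩ := tendsto_subseq_of_bounded Metric.isBounded_closedBall hbd
  have hlim' (i : Fin d) : Tendsto (fun s => f (φ s) i) atTop (nhds (e' i)) :=
    (tendsto_pi_nhds.1 hlim) i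
  have horth : Orthonormal ℂ e' := by
    rw [orthonormal_iff_ite]
    intro i j
    have h1 := (hlim' i).inner (𝕜 := ℂ) (hlim' j)
    have h2 : (fun s => inner ℂ (f (φ s) i) (f (φ s) j)) =
        fun _ => if i = j then (1 : ℂ) else 0 :=
      funext fun s => orthonormal_iff_ite.1 (hf (φ s)) i j
    rw [h2] at h1
    exact tendsto_nhds_unique h1 tendsto_const_nhds
  refine ⟨φ, fun s i => f (φ s) i, fun i => e' i, hφ, ?_, fun s i ρ hρ => hker _ i ρ hρ,
    fun i p => ?_⟩
  · exact horth.linearIndependent.map' (WithLp.linearEquiv 2 ℂ (B → ℂ)).toLinearMap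
      (LinearEquiv.ker _)
  · exact ((EuclideanSpace.proj p : EuclideanSpace ℂ B →L[ℂ] ℂ).continuous.tendsto _).comp
      (hlim' i)

theorem koszulEntry_sum_mul {κ : Type*} (s : Finset κ) (J I : Finset ℕ) (u : κ → ℕ → ℂ)
    (z : κ → ℂ) :
    koszulEntry J I (fun k => ∑ ρ ∈ s, u ρ k * z ρ) = ∑ ρ ∈ s, koszulEntry J I (u ρ) * z ρ := by
  simp only [koszulEntry, Finset.sum_mul]
  rw [Finset.sum_comm]
  refine Finset.sum_congr rfl fun k _ => ?_
  split_ifs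
  · rw [Finset.mul_sum]
    exact Finset.sum_congr rfl fun ρ _ => by ring
  · simp

/-- Koszul flattening bound for border rank, applied after substitution by the kernel of `c` of
the linear forms. -/
theorem mul_le_of_tendsto_matMul (N r c : ℕ) (hc : c ≤ (N + 1) ^ 2)
    (a b w : ℕ → Fin r → Fin (N + 1) × Fin (N + 1) → ℂ)
    (hT : ∀ p q o : Fin (N + 1) × Fin (N + 1),
      Tendsto (fun s => ∑ ρ, a s ρ p * b s ρ q * w s ρ o) atTop
        (nhds (if p.2 = q.1 ∧ q.2 = o.1 ∧ o.2 = p.1 then 1 else 0))) :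
    ((N + 1) * (2 * N + 1).choose N - (N + c).choose (N + 1)) * (N + 1) ≤
      (r - c) * (2 * N).choose N := by
  classical
  obtain ⟨φ, e, e', hφ, hind, hker, hlim⟩ := exists_subseq_linearIndependent_kernel r c
    ((N + 1) ^ 2 - c) (by simp only [Fintype.card_prod, Fintype.card_fin, ← sq]; omega) a
  set E : Fin ((N + 1) ^ 2 - c) → Matrix (Fin (N + 1)) (Fin (N + 1)) ℂ :=
    fun i => Matrix.of fun k l => e' i (k, l) with hE
  have hEind : LinearIndependent ℂ E := by
    rw [Fintype.linearIndependent_iff] at hind ⊢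
    intro g hg
    refine hind g (funext fun p => ?_)
    have := congrFun (congrFun hg p.1) p.2
    simpa [hE, Matrix.sum_apply] using this
  obtain ⟨ι, _, _, J, I, α, β, X, hJ, hI, hR, hX, hdet⟩ :=
    (Submodule.span ℂ (Set.range E)).hasKoszulMinor N c (by
      rw [finrank_span_eq_card hEind, Fintype.card_fin]; omega)
  choose x hx using fun k => (Submodule.mem_span_range_iff_exists_fun ℂ).1 (hX k)
  set Y : ℕ → ℕ → Fin (N + 1) × Fin (N + 1) → ℂ := fun s k p => ∑ i, x k i * e s i p with hY
  have hYlim (k : ℕ) (p : Fin (N + 1) × Fin (N + 1)) :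
      Tendsto (fun s => Y s k p) atTop (nhds (X k p.1 p.2)) := by
    have : X k p.1 p.2 = ∑ i, x k i * e' i p := by
      rw [← hx k, Matrix.sum_apply]
      rfl
    rw [this]
    exact tendsto_finsetSum _ fun i _ => (hlim i p).const_mul _
  set M : ℕ → Matrix (ι × Fin (N + 1)) (ι × Fin (N + 1)) ℂ := fun s => Matrix.of fun m m' =>
    koszulEntry (J m.1) (I m'.1) fun k => ∑ p, ∑ j, ∑ i, Y s k p * β m'.1 j * α m.1 i *
      ∑ ρ, a (φ s) ρ p * b (φ s) ρ (j, m'.2) * w (φ s) ρ (m.2, i) with hM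
  have hMlim : Tendsto (fun s => (M s).det) atTop
      (nhds (Matrix.blockDiagonal fun _ : Fin (N + 1) => koszulMinor J I α β X).det) := by
    refine Matrix.tendsto_det fun m m' => ?_
    have h1 : (Matrix.blockDiagonal fun _ : Fin (N + 1) => koszulMinor J I α β X) m m' =
        koszulEntry (J m.1) (I m'.1) fun k => ∑ p : Fin (N + 1) × Fin (N + 1), ∑ j, ∑ i,
          X k p.1 p.2 * β m'.1 j * α m.1 i *
            if p.2 = j ∧ m'.2 = m.2 ∧ i = p.1 then 1 else 0 := by
      rw [Matrix.blockDiagonal_apply]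
      by_cases h : m.2 = m'.2
      · rw [if_pos h]
        simp only [koszulMinor, Matrix.of_apply]
        congr 1
        ext k
        rw [Fintype.sum_prod_type]
        simp only [h, true_and, ite_and, mul_ite, mul_one, mul_zero, dotProduct,
          Matrix.mulVec, Finset.mul_sum]
        refine Finset.sum_congr rfl fun i _ => Finset.sum_congr rfl fun j _ => ?_
        rw [Finset.sum_eq_single j]
        · simp
          ring
        · intro j' _ hj
          simp [hj.symm]
        · simp
      · rw [if_neg h]
        simp [Ne.symm h, koszulEntry]
    rw [h1]
    refine koszulEntry_tendsto _ _ fun k _ => ?_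
    refine tendsto_finsetSum _ fun p _ => tendsto_finsetSum _ fun j _ =>
      tendsto_finsetSum _ fun i _ => ?_
    exact (((hYlim k p).mul_const _).mul_const _).mul
      ((hT p (j, m'.2) (m.2, i)).comp hφ.tendsto_atTop)
  have hne : (Matrix.blockDiagonal fun _ : Fin (N + 1) => koszulMinor J I α β X).det ≠ 0 := by
    rw [Matrix.det_blockDiagonal]
    exact Finset.prod_ne_zero_iff.2 fun _ _ => hdet
  obtain ⟨s, hs⟩ := (hMlim.eventually_ne hne).exists
  set u : Fin r → ℕ → ℂ := fun ρ k => ∑ p, a (φ s) ρ p * Y s k p with hu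
  have hu0 (ρ : Fin r) (hρ : (ρ : ℕ) < c) (k : ℕ) : u ρ k = 0 := by
    simp only [hu, hY, Finset.mul_sum]
    rw [Finset.sum_comm]
    refine Finset.sum_eq_zero fun i _ => ?_
    have := congrArg (x k i * ·) (hker s i ρ hρ)
    simp only [Finset.mul_sum, mul_zero] at this
    rw [← this]
    exact Finset.sum_congr rfl fun p _ => by ring
  choose A D hAD using fun ρ : Fin r => exists_koszulEntry_factorization N (u ρ)
  set v : Fin r → ι × Fin (N + 1) → ℂ := fun ρ m => ∑ j, β m.1 j * b (φ s) ρ (j, m.2) with hv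
  set z : Fin r → ι × Fin (N + 1) → ℂ := fun ρ m => ∑ i, α m.1 i * w (φ s) ρ (m.2, i) with hz
  have hentry (m m' : ι × Fin (N + 1)) :
      M s m m' = ∑ ρ, koszulEntry (J m.1) (I m'.1) (u ρ) * (z ρ m * v ρ m') := by
    rw [← koszulEntry_sum_mul]
    simp only [hM, Matrix.of_apply]
    congr 1
    ext k
    simp only [hu, hv, hz, Finset.mul_sum, Finset.sum_mul]
    conv_lhs =>
      enter [2, p, 2, j]
      rw [Finset.sum_comm]
    conv_lhs =>
      enter [2, p]
      rw [Finset.sum_comm]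
    rw [Finset.sum_comm]
    refine Finset.sum_congr rfl fun ρ _ => ?_
    rw [Finset.sum_comm]
    refine Finset.sum_congr rfl fun j _ => ?_
    rw [Finset.sum_comm]
    exact Finset.sum_congr rfl fun i _ => Finset.sum_congr rfl fun p _ => by ring
  have hcard := card_le_card_of_factorization (M s) hs
    (κ := {ρ : Fin r // ¬ (ρ : ℕ) < c} × Fin ((2 * N).choose N))
    (Matrix.of fun m i => A i.1 (J m.1) i.2 * z i.1 m)
    (Matrix.of fun i m' => D i.1 i.2 (I m'.1) * v i.1 m') (by
      ext m m'
      rw [hentry, Matrix.mul_apply, Fintype.sum_prod_type]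
      rw [← Finset.sum_filter_add_sum_filter_not Finset.univ fun ρ : Fin r => (ρ : ℕ) < c]
      rw [Finset.sum_eq_zero, zero_add, Finset.sum_subtype (p := fun ρ : Fin r => ¬ (ρ : ℕ) < c)
        _ (fun ρ => by simp)]
      · refine Finset.sum_congr rfl fun ρ _ => ?_
        rw [hAD ρ _ (hJ _) _ (hI _), Finset.sum_mul]
        refine Finset.sum_congr rfl fun i _ => ?_
        simp only [Matrix.of_apply]
        ring
      · intro ρ hρ
        have : u ρ = fun _ => 0 := funext (hu0 ρ (Finset.mem_filter.1 hρ).2)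
        simp [this, koszulEntry])
  have hρcard : Fintype.card {ρ : Fin r // ¬ (ρ : ℕ) < c} ≤ r - c := by
    have := Fintype.card_le_of_injective
      (fun ρ : {ρ : Fin r // ¬ (ρ : ℕ) < c} => (⟨ρ.1 - c, by
        have h1 := ρ.1.2
        have h2 := ρ.2
        omega⟩ : Fin (r - c)))
      fun ρ ρ' h => Subtype.ext (Fin.ext (by
        have h1 := ρ.2
        have h2 := ρ'.2
        simp only [Fin.mk.injEq] at h
        omega))
    simpa using this
  simp only [Fintype.card_prod, Fintype.card_fin] at hcard
  exact (Nat.mul_le_mul_right _ hR).trans (hcard.trans (Nat.mul_le_mul_right _ hρcard))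

/-- The exponent of the monomial `x_p y_q z_o`. -/
noncomputable def trilinearExponent {B : Type*} (p q o : B) : (Fin 3 × B) →₀ ℕ :=
  Finsupp.single (0, p) 1 + Finsupp.single (1, q) 1 + Finsupp.single (2, o) 1

theorem trilinearExponent_injective {B : Type*} {p q o p' q' o' : B}
    (h : trilinearExponent p' q' o' = trilinearExponent p q o) : p' = p ∧ q' = q ∧ o' = o := by
  classical
  have h0 := DFunLike.congr_fun h (0, p)
  have h1 := DFunLike.congr_fun h (1, q)
  have h2 := DFunLike.congr_fun h (2, o)
  simp [trilinearExponent, Finsupp.single_apply] at h0 h1 h2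
  exact ⟨h0, h1, h2⟩

theorem coeff_C_mul_X_mul {B : Type*} [DecidableEq B] (x y z : ℂ) (p q o p' q' o' : B) :
    coeff (trilinearExponent p q o) ((C x * X ((0 : Fin 3), p')) * (C y * X ((1 : Fin 3), q')) *
      (C z * X ((2 : Fin 3), o'))) = if p' = p ∧ q' = q ∧ o' = o then x * y * z else 0 := by
  rw [C_mul_X_eq_monomial, C_mul_X_eq_monomial, C_mul_X_eq_monomial, monomial_mul, monomial_mul,
    coeff_monomial]
  refine if_congr ⟨fun h => trilinearExponent_injective h, ?_⟩ rfl rfl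
  rintro ⟨rfl, rfl, rfl⟩
  rfl

theorem coeff_linForm_mul {B : Type*} [Fintype B] (a b c : B → ℂ) (p q o : B) :
    coeff (trilinearExponent p q o) ((∑ p, C (a p) * X ((0 : Fin 3), p)) *
      (∑ p, C (b p) * X ((1 : Fin 3), p)) * (∑ p, C (c p) * X ((2 : Fin 3), p))) =
      a p * b q * c o := by
  classical
  simp only [Finset.sum_mul, Finset.mul_sum, coeff_sum, coeff_C_mul_X_mul, ite_and]
  simp

theorem coeff_matMulPoly (m : ℕ) (p q o : Fin m × Fin m) :
    coeff (trilinearExponent p q o) (matMulPoly m) =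
      if p.2 = q.1 ∧ q.2 = o.1 ∧ o.2 = p.1 then 1 else 0 := by
  have h (i j k : Fin m) := coeff_C_mul_X_mul 1 1 1 p q o (i, j) (j, k) (k, i)
  simp only [C_1, one_mul, mul_one] at h
  simp only [matMulPoly, coeff_sum, h]
  obtain ⟨p1, p2⟩ := p
  obtain ⟨q1, q2⟩ := q
  obtain ⟨o1, o2⟩ := o
  simp only [Prod.mk.injEq]
  rw [Finset.sum_eq_single p1, Finset.sum_eq_single p2, Finset.sum_eq_single q2]
  · refine if_congr ⟨?_, ?_⟩ rfl rfl
    · rintro ⟨-, ⟨h1, -⟩, h2, h3⟩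
      exact ⟨h1, h2, h3.symm⟩
    · rintro ⟨h1, h2, h3⟩
      exact ⟨⟨rfl, rfl⟩, ⟨h1, rfl⟩, h2, h3.symm⟩
  · exact fun k _ hk => if_neg fun h => hk h.2.1.2
  · simp
  · exact fun j _ hj => Finset.sum_eq_zero fun k _ => if_neg fun h => hj h.1.2
  · simp
  · exact fun i _ hi => Finset.sum_eq_zero fun j _ => Finset.sum_eq_zero fun k _ =>
      if_neg fun h => hi h.1.1
  · simp

theorem le_of_koszul_bound (N r : ℕ)
    (h : ((N + 1) * (2 * N + 1).choose N -
        (N + (N - Nat.clog 2 (N + 1))).choose (N + 1)) * (N + 1) ≤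
      (r - (N - Nat.clog 2 (N + 1))) * (2 * N).choose N) :
    (2 * ((N + 1 : ℕ) : ℤ) ^ 2 - Nat.clog 2 (N + 1) - 1) ≤ (r : ℤ) := by
  have hq : Nat.clog 2 (N + 1) ≤ N := Nat.clog_le_of_le_pow Nat.lt_two_pow_self
  have hpow : N + 1 ≤ 2 ^ Nat.clog 2 (N + 1) := Nat.le_pow_clog one_lt_two _
  have hlt := succ_mul_choose_lt_centralBinom N _ hq hpow
  set q := Nat.clog 2 (N + 1)
  have hchoose : (2 * N + 1).choose N * (N + 1) = (2 * N + 1) * (2 * N).choose N := by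
    rw [← Nat.choose_symm_half, ← Nat.add_one_mul_choose_eq]
  generalize (2 * N).choose N = D at *
  have h1 : (N + 1) * (2 * N + 1) * D < (r - (N - q) + 1) * D := by
    rw [Nat.sub_mul, mul_assoc, hchoose, ← mul_assoc, mul_comm (Nat.choose _ _) (N + 1),
      tsub_le_iff_right] at h
    rw [add_mul (r - (N - q)), one_mul]
    exact h.trans_lt (Nat.add_lt_add_left hlt _)
  have h2 : (N + 1) * (2 * N + 1) < r - (N - q) + 1 := lt_of_mul_lt_mul_right h1 (Nat.zero_le _)
  have h3 : (N + 1) * (2 * N + 1) + (N - q) ≤ r := by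
    have : 0 < (N + 1) * (2 * N + 1) := by positivity
    omega
  zify [hq] at h3
  push_cast
  linarith

/-- **Landsberg–Michałek border rank lower bound for matrix multiplication**: if the
matrix multiplication polynomial `T` is a limit (coefficientwise) of polynomials of the
form `∑_{ρ=1}^r u_ρ v_ρ w_ρ` with linear forms `u_ρ` in the `x`-variables, `v_ρ` in the
`y`-variables and `w_ρ` in the `z`-variables, then `r ≥ 2m² − ⌈log₂ m⌉ − 1`. -/
theorem landsberg_michalek_border_rank_lower_bound (m r : ℕ) (hm : 1 ≤ m)
    (g : ℕ → MvPolynomial (Fin 3 × (Fin m × Fin m)) ℂ)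
    (hg : ∀ s, ∃ u v w : Fin r → MvPolynomial (Fin 3 × (Fin m × Fin m)) ℂ,
      (∀ ρ, IsLinForm m 0 (u ρ)) ∧ (∀ ρ, IsLinForm m 1 (v ρ)) ∧
      (∀ ρ, IsLinForm m 2 (w ρ)) ∧ g s = ∑ ρ, u ρ * v ρ * w ρ)
    (hconv : ∀ d : (Fin 3 × (Fin m × Fin m)) →₀ ℕ,
      Tendsto (fun s => (g s).coeff d) atTop (nhds ((matMulPoly m).coeff d))) :
    (2 * (m : ℤ) ^ 2 - Nat.clog 2 m - 1) ≤ (r : ℤ) := by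
  obtain ⟨N, rfl⟩ : ∃ N, m = N + 1 := ⟨m - 1, by omega⟩
  choose u v w hu hv hw hsum using hg
  choose a ha using hu
  choose b hb using hv
  choose c hc using hw
  refine le_of_koszul_bound N r (mul_le_of_tendsto_matMul N r _ ?_ a b c fun p q o => ?_)
  · exact (Nat.sub_le _ _).trans (by nlinarith)
  · have h1 := hconv (trilinearExponent p q o)
    rw [coeff_matMulPoly] at h1
    refine h1.congr fun s => ?_
    rw [hsum, coeff_sum]
    exact Finset.sum_congr rfl fun ρ _ => by rw [ha, hb, hc, coeff_linForm_mul]
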